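/- arXiv:0708.1116 — 7 statements merged into one kernel-verified Lean document; each statement's English description precedes it below -/
import Mathlib

section
/- Fix integers a ≥ 2, d ≥ 1, L ≥ 1, N ≥ 1 with a ≥ L and N·L ≤ a^(d−1)·⌊a/L⌋. Then the configuration graph of N polymers of length L on the d-dimensional torus of side a is connected: any configuration can be transformed into any other by a finite sequence of moves each of which replaces exactly one polymer. -/
/-- Two vertices of the `d`-dimensional torus of side `a` are adjacent iff they agree in all
but exactly one coordinate, in which they differ by `+1` or `-1` in `ZMod a`. -/
def torusAdj (a d : ℕ) (u v : Fin d → ZMod a) : Prop :=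
  ∃ i : Fin d, (∀ j, j ≠ i → u j = v j) ∧ (v i = u i + 1 ∨ v i = u i - 1)

/-- A self-avoiding path of length `L` on the `d`-dimensional torus of side `a`. -/
structure SAPath (a d L : ℕ) where
  toFun : Fin L → (Fin d → ZMod a)
  inj : Function.Injective toFun
  adj : ∀ i : ℕ, ∀ h : i + 1 < L,
    torusAdj a d (toFun ⟨i, Nat.lt_of_succ_lt h⟩) (toFun ⟨i + 1, h⟩)

/-- Two self-avoiding paths are identified if one is the reversal of the other. -/
def pathRel {a d L : ℕ} (p q : SAPath a d L) : Prop :=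
  q.toFun = p.toFun ∨ q.toFun = p.toFun ∘ Fin.rev

instance polymerSetoid (a d L : ℕ) : Setoid (SAPath a d L) where
  r := pathRel
  iseqv := by
    constructor
    · intro p; exact Or.inl rfl
    · intro p q h
      rcases h with h | h
      · exact Or.inl h.symm
      · refine Or.inr ?_
        rw [h]
        funext i
        simp [Function.comp, Fin.rev_rev]
    · intro p q r h1 h2
      rcases h1 with h1 | h1 <;> rcases h2 with h2 | h2
      · exact Or.inl (h2.trans h1)
      · exact Or.inr (by rw [h2, h1])
      · exact Or.inr (by rw [h2, h1])
      · refine Or.inl ?_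
        rw [h2, h1]
        funext i
        simp [Function.comp, Fin.rev_rev]

/-- A polymer: a self-avoiding path up to reversal. -/
def Polymer (a d L : ℕ) := Quotient (polymerSetoid a d L)

noncomputable instance (a d L : ℕ) : DecidableEq (Polymer a d L) := Classical.decEq _

/-- The support of a polymer: the set of vertices it occupies. -/
def Polymer.support {a d L : ℕ} : Polymer a d L → Set (Fin d → ZMod a) :=
  Quotient.lift (fun p => Set.range p.toFun) (by
    intro p q h
    rcases h with h | h
    · show Set.range p.toFun = Set.range q.toFun
      rw [h]
    · show Set.range p.toFun = Set.range q.toFun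
      rw [h]
      exact ((Fin.rev_involutive).surjective.range_comp p.toFun).symm)

/-- A configuration of `N` polymers of length `L` on the `d`-dimensional torus of side `a`:
`N` self-avoiding paths (up to reversal) with pairwise disjoint supports. -/
structure Config (a d L N : ℕ) where
  polymers : Finset (Polymer a d L)
  card_eq : polymers.card = N
  disj : ∀ P ∈ polymers, ∀ Q ∈ polymers, P ≠ Q →
    Disjoint (Polymer.support P) (Polymer.support Q)

/-- The configuration graph: two configurations are adjacent iff they are distinct and their
intersection contains exactly `N - 1` polymers. -/
noncomputable def configGraph (a d L N : ℕ) : SimpleGraph (Config a d L N) where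
  Adj S S' := S ≠ S' ∧ (S.polymers ∩ S'.polymers).card = N - 1
  symm := by
    constructor
    intro S S' h
    exact ⟨h.1.symm, by rw [Finset.inter_comm]; exact h.2⟩
  loopless := by constructor; intro S h; exact h.1 rfl

theorem cg_replace {a d L N : ℕ} (S : Config a d L N) (P Q : Polymer a d L)
    (hP : P ∈ S.polymers) (hQ : Q ∉ S.polymers)
    (hdis : ∀ R ∈ S.polymers.erase P, Disjoint Q.support R.support) :
    ∃ S' : Config a d L N, S'.polymers = insert Q (S.polymers.erase P) ∧
      (configGraph a d L N).Reachable S S' := by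
  have hQ' : Q ∉ S.polymers.erase P := fun h => hQ (Finset.mem_of_mem_erase h)
  have hpos : 0 < S.polymers.card := Finset.card_pos.mpr ⟨P, hP⟩
  have hc := S.card_eq
  refine ⟨⟨insert Q (S.polymers.erase P), ?_, ?_⟩, rfl, ?_⟩
  · rw [Finset.card_insert_of_notMem hQ', Finset.card_erase_of_mem hP]
    omega
  · intro A hA B hB hAB
    rcases Finset.mem_insert.mp hA with rfl | hA2
    · rcases Finset.mem_insert.mp hB with rfl | hB
      · exact absurd rfl hAB
      · exact hdis B hB
    · rcases Finset.mem_insert.mp hB with rfl | hB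
      · exact (hdis A hA2).symm
      · exact S.disj A (Finset.mem_of_mem_erase hA2) B (Finset.mem_of_mem_erase hB) hAB
  · refine SimpleGraph.Adj.reachable ⟨?_, ?_⟩
    · intro h
      apply hQ
      rw [h]
      exact Finset.mem_insert_self _ _
    · have : S.polymers ∩ insert Q (S.polymers.erase P) = S.polymers.erase P := by
        ext x
        simp only [Finset.mem_inter, Finset.mem_insert, Finset.mem_erase]
        constructor
        · rintro ⟨h1, rfl | h2⟩
          · exact absurd h1 hQ
          · exact h2
        · intro h
          exact ⟨h.2, Or.inr h⟩
      show (S.polymers ∩ insert Q (S.polymers.erase P)).card = N - 1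
      rw [this, Finset.card_erase_of_mem hP, hc]

theorem cg_support_nonempty {a d L : ℕ} (hL : 1 ≤ L) (P : Polymer a d L) :
    P.support.Nonempty := by
  induction P using Quotient.inductionOn with
  | h p => exact ⟨p.toFun ⟨0, hL⟩, ⟨_, rfl⟩⟩

theorem cg_hit {a d L : ℕ} (W : Finset (Polymer a d L))
    (hW : ∀ P ∈ W, ∀ Q ∈ W, P ≠ Q → Disjoint P.support Q.support) (R : Polymer a d L)
    [inst : ∀ Q : Polymer a d L, Decidable (¬ Disjoint Q.support R.support)] :
    (W.filter fun Q => ¬ Disjoint Q.support R.support).card ≤ L := by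
  obtain ⟨p, rfl⟩ := Quotient.exists_rep R
  · have key : ∀ Q : Polymer a d L, ∃ i : Option (Fin L),
        ¬ Disjoint Q.support (Polymer.support (Quotient.mk _ p)) →
          ∃ j, i = some j ∧ p.toFun j ∈ Q.support := by
      intro Q
      by_cases h : Disjoint Q.support (Polymer.support (Quotient.mk _ p))
      · exact ⟨none, fun h' => absurd h h'⟩
      · obtain ⟨x, hx, ⟨j, hj⟩⟩ := Set.not_disjoint_iff.mp h
        exact ⟨some j, fun _ => ⟨j, rfl, by rw [hj]; exact hx⟩⟩
    choose f hf using key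
    have h := Finset.card_le_card_of_injOn (t := (Finset.univ : Finset (Fin L)).map
      ⟨some, Option.some_injective _⟩) f
      (s := W.filter fun Q => ¬ Disjoint Q.support (Polymer.support (Quotient.mk _ p))) ?_ ?_
    · simpa using h
    · intro Q hQ
      obtain ⟨j, hj, -⟩ := hf Q (Finset.mem_filter.mp hQ).2
      simp [hj]
    · intro Q hQ Q' hQ' he
      have hQ1 := Finset.mem_filter.mp hQ
      have hQ2 := Finset.mem_filter.mp hQ'
      obtain ⟨j, hj, hm⟩ := hf Q hQ1.2
      obtain ⟨j', hj', hm'⟩ := hf Q' hQ2.2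
      have : j = j' := by
        apply Option.some_injective
        rw [← hj, ← hj', he]
      subst this
      by_contra hne
      exact Set.disjoint_left.mp (hW Q hQ1.1 Q' hQ2.1 hne) hm hm'

theorem cg_free {a d L N : ℕ} (hL : 1 ≤ L) (W : Finset (Polymer a d L))
    (hW : ∀ P ∈ W, ∀ Q ∈ W, P ≠ Q → Disjoint P.support Q.support)
    (hc : N * L ≤ W.card) (S : Config a d L N) (P : Polymer a d L) (hP : P ∈ S.polymers) :
    ∃ Q ∈ W, ∀ R ∈ S.polymers.erase P, Disjoint Q.support R.support := by
  classical
  by_contra! hcon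
  have hsub : W ⊆ (S.polymers.erase P).biUnion
      (fun R => W.filter fun Q => ¬ Disjoint Q.support R.support) := by
    intro Q hQ
    obtain ⟨R, hR, hn⟩ := hcon Q hQ
    exact Finset.mem_biUnion.mpr ⟨R, hR, Finset.mem_filter.mpr ⟨hQ, hn⟩⟩
  have h1 := (Finset.card_le_card hsub).trans
    (Finset.card_biUnion_le_card_mul _ _ L (fun R _ => cg_hit W hW R))
  have hpos : 0 < S.polymers.card := Finset.card_pos.mpr ⟨P, hP⟩
  rw [Finset.card_erase_of_mem hP, S.card_eq] at h1
  rw [S.card_eq] at hpos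
  have : (N - 1) * L < N * L := Nat.mul_lt_mul_of_pos_right (by omega) hL
  omega

theorem cg_step1 {a d L N : ℕ} (hL : 1 ≤ L) (W : Finset (Polymer a d L))
    (hW : ∀ P ∈ W, ∀ Q ∈ W, P ≠ Q → Disjoint P.support Q.support)
    (hc : N * L ≤ W.card) : ∀ (n : ℕ) (S : Config a d L N), (S.polymers \ W).card = n →
    ∃ T : Config a d L N, T.polymers ⊆ W ∧ (configGraph a d L N).Reachable S T := by
  intro n
  induction n with
  | zero =>
    intro S h
    exact ⟨S, Finset.sdiff_eq_empty_iff_subset.mp (Finset.card_eq_zero.mp h),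
      SimpleGraph.Reachable.refl _⟩
  | succ n ih =>
    intro S h
    obtain ⟨P, hP⟩ := Finset.card_pos.mp (by omega : 0 < (S.polymers \ W).card)
    have hP' := Finset.mem_sdiff.mp hP
    obtain ⟨Q, hQ, hd⟩ := cg_free hL W hW hc S P hP'.1
    have hQS : Q ∉ S.polymers := by
      intro hm
      have hne : Q ≠ P := fun e => hP'.2 (e ▸ hQ)
      have := hd Q (Finset.mem_erase.mpr ⟨hne, hm⟩)
      rw [disjoint_self] at this
      exact (cg_support_nonempty hL Q).ne_empty this
    obtain ⟨S', hS', hr⟩ := cg_replace S P Q hP'.1 hQS hd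
    have hs : S'.polymers \ W = (S.polymers \ W).erase P := by
      rw [hS']
      ext x
      simp only [Finset.mem_sdiff, Finset.mem_insert, Finset.mem_erase]
      constructor
      · rintro ⟨rfl | h1, h2⟩
        · exact absurd hQ h2
        · exact ⟨h1.1, h1.2, h2⟩
      · rintro ⟨h1, h2, h3⟩
        exact ⟨Or.inr ⟨h1, h2⟩, h3⟩
    obtain ⟨T, hT, hr'⟩ := ih S' (by rw [hs, Finset.card_erase_of_mem hP, h]; rfl)
    exact ⟨T, hT, hr.trans hr'⟩

theorem cg_step2 {a d L N : ℕ} (W : Finset (Polymer a d L))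
    (hW : ∀ P ∈ W, ∀ Q ∈ W, P ≠ Q → Disjoint P.support Q.support)
    (T : Config a d L N) (hT : T.polymers ⊆ W) :
    ∀ (n : ℕ) (S : Config a d L N), S.polymers ⊆ W → (S.polymers \ T.polymers).card = n →
    (configGraph a d L N).Reachable S T := by
  intro n
  induction n with
  | zero =>
    intro S _ h
    have hs := Finset.sdiff_eq_empty_iff_subset.mp (Finset.card_eq_zero.mp h)
    have he := Finset.eq_of_subset_of_card_le hs (by rw [S.card_eq, T.card_eq])
    have : S = T := by
      cases S; cases T; simp only at he; subst he; rfl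
    rw [this]
  | succ n ih =>
    intro S hS h
    obtain ⟨P, hP⟩ := Finset.card_pos.mp (by omega : 0 < (S.polymers \ T.polymers).card)
    have hP' := Finset.mem_sdiff.mp hP
    have hcard : (T.polymers \ S.polymers).card = (S.polymers \ T.polymers).card :=
      Finset.card_sdiff_comm (by rw [S.card_eq, T.card_eq])
    obtain ⟨Q, hQ⟩ := Finset.card_pos.mp (by omega : 0 < (T.polymers \ S.polymers).card)
    have hQ' := Finset.mem_sdiff.mp hQ
    obtain ⟨S', hS', hr⟩ := cg_replace S P Q hP'.1 hQ'.2 (by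
      intro R hR
      have hR' := Finset.mem_of_mem_erase hR
      exact hW Q (hT hQ'.1) R (hS hR') (fun e => hQ'.2 (e ▸ hR')))
    have hs : S'.polymers \ T.polymers = (S.polymers \ T.polymers).erase P := by
      rw [hS']
      ext x
      simp only [Finset.mem_sdiff, Finset.mem_insert, Finset.mem_erase]
      constructor
      · rintro ⟨rfl | h1, h2⟩
        · exact absurd hQ'.1 h2
        · exact ⟨h1.1, h1.2, h2⟩
      · rintro ⟨h1, h2, h3⟩
        exact ⟨Or.inr ⟨h1, h2⟩, h3⟩
    refine hr.trans (ih S' ?_ (by rw [hs, Finset.card_erase_of_mem hP, h]; rfl))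
    rw [hS']
    intro x hx
    rcases Finset.mem_insert.mp hx with rfl | hx
    · exact hT hQ'.1
    · exact hS (Finset.mem_of_mem_erase hx)

theorem cg_lt {a L : ℕ} (k : Fin (a / L)) (i : Fin L) : k.1 * L + i.1 < a := by
  have h1 : (k.1 + 1) * L ≤ a / L * L := Nat.mul_le_mul_right _ k.2
  have h2 := Nat.div_mul_le_self a L
  have h3 := i.2
  rw [add_mul] at h1
  omega

theorem cg_cast {a x y : ℕ} (hx : x < a) (hy : y < a) (h : (x : ZMod a) = (y : ZMod a)) :
    x = y := by
  rw [ZMod.natCast_eq_natCast_iff] at h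
  exact Nat.ModEq.eq_of_lt_of_lt h hx hy

/-- Straight path in the slot `k` of the line in direction `0` through `f`. -/
def cgSlot {a d L : ℕ} (f : Fin d → ZMod a) (k : Fin (a / L)) : SAPath a (d + 1) L where
  toFun i := Fin.cons (((k.1 * L + i.1 : ℕ) : ZMod a)) f
  inj := by
    intro i j h
    have h0 := congrFun h 0
    simp only [Fin.cons_zero] at h0
    have := cg_cast (cg_lt k i) (cg_lt k j) h0
    exact Fin.ext (by omega)
  adj := by
    intro i h
    refine ⟨0, ?_, Or.inl ?_⟩
    · intro j hj
      obtain ⟨j', rfl⟩ := Fin.exists_succ_eq.mpr hj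
      simp only [Fin.cons_succ]
    · simp only [Fin.cons_zero]
      push_cast
      ring

theorem cg_slot_meet {a d L : ℕ} (f g : Fin d → ZMod a) (k l : Fin (a / L))
    (h : ¬ Disjoint (Polymer.support (Quotient.mk _ (cgSlot f k)))
      (Polymer.support (Quotient.mk _ (cgSlot g l)))) : f = g ∧ k = l := by
  obtain ⟨x, ⟨i, hi⟩, ⟨j, hj⟩⟩ := Set.not_disjoint_iff.mp h
  have he : (cgSlot f k).toFun i = (cgSlot g l).toFun j := hi.trans hj.symm
  constructor
  · funext t
    have := congrFun he t.succ
    simpa [cgSlot] using this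
  · have h0 := congrFun he 0
    simp only [cgSlot, Fin.cons_zero] at h0
    have h1 := cg_cast (cg_lt k i) (cg_lt l j) h0
    have h2 := i.2
    have h3 := j.2
    have hk : (k.1 * L + i.1) / L = k.1 := by
      rw [mul_comm, Nat.mul_add_div (by omega), Nat.div_eq_of_lt h2, add_zero]
    have hl : (l.1 * L + j.1) / L = l.1 := by
      rw [mul_comm, Nat.mul_add_div (by omega), Nat.div_eq_of_lt h3, add_zero]
    exact Fin.ext (by rw [← hk, ← hl, h1])

theorem configGraph_preconnected_of_low_density
    (a d L N : ℕ) (ha : 2 ≤ a) (hd : 1 ≤ d) (hL : 1 ≤ L) (hN : 1 ≤ N)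
    (haL : L ≤ a) (hdens : N * L ≤ a ^ (d - 1) * (a / L)) :
    (configGraph a d L N).Preconnected := by
  obtain ⟨d, rfl⟩ : ∃ e, d = e + 1 := ⟨d - 1, by omega⟩
  have : NeZero a := ⟨by omega⟩
  let F : (Fin d → ZMod a) × Fin (a / L) → Polymer a (d + 1) L :=
    fun x => Quotient.mk _ (cgSlot x.1 x.2)
  have hF : ∀ x y, ¬ Disjoint (F x).support (F y).support → x = y := by
    intro x y h
    obtain ⟨h1, h2⟩ := cg_slot_meet _ _ _ _ h
    exact Prod.ext h1 h2
  have hinj : Function.Injective F := by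
    intro x y h
    apply hF
    rw [h, disjoint_self]
    exact (cg_support_nonempty hL _).ne_empty
  let W : Finset (Polymer a (d + 1) L) := Finset.univ.map ⟨F, hinj⟩
  have hW : ∀ P ∈ W, ∀ Q ∈ W, P ≠ Q → Disjoint P.support Q.support := by
    intro P hP Q hQ hne
    obtain ⟨x, -, rfl⟩ := Finset.mem_map.mp hP
    obtain ⟨y, -, rfl⟩ := Finset.mem_map.mp hQ
    by_contra hcon
    exact hne (congrArg _ (hF x y hcon))
  have hc : N * L ≤ W.card := by
    simpa [W, ZMod.card] using hdens
  intro S T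
  obtain ⟨S', hS', hr⟩ := cg_step1 hL W hW hc _ S rfl
  obtain ⟨T', hT', hr'⟩ := cg_step1 hL W hW hc _ T rfl
  exact (hr.trans (cg_step2 W hW T' hT' _ S' hS' rfl)).trans hr'.symm
end

section
/- Fix integers a ≥ 2, d ≥ 1, N ≥ 2, L ≥ 2 with N·L = a^d (density ρ = 1). Then the configuration graph of N polymers of length L on the d-dimensional torus of side a is not connected. -/
/-- The cyclic modular Gray code. -/
def grayH (a d : ℕ) (n : ℕ) : Fin d → ZMod a := fun j =>
  ((n / a ^ (j : ℕ) : ℕ) : ZMod a) -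
    (if (j : ℕ) + 1 < d then ((n / a ^ ((j : ℕ) + 1) : ℕ) : ZMod a) else 0)

lemma grayH_digits {a d m n : ℕ} (h : grayH a d m = grayH a d n) :
    ∀ k j, j < d → d ≤ j + k →
      ((m / a ^ j : ℕ) : ZMod a) = ((n / a ^ j : ℕ) : ZMod a) := by
  intro k
  induction k with
  | zero => intro j h1 h2; omega
  | succ k ih =>
    intro j h1 h2
    have hj := congrFun h ⟨j, h1⟩
    simp only [grayH] at hj
    by_cases hc : j + 1 < d
    · rw [if_pos hc, if_pos hc, ih (j+1) hc (by omega)] at hj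
      exact sub_left_injective hj
    · rw [if_neg hc, if_neg hc] at hj
      simpa using hj

lemma modEq_of_digits {a : ℕ} (ha : 2 ≤ a) : ∀ (d m n : ℕ),
    (∀ j, j < d → m / a ^ j ≡ n / a ^ j [MOD a]) → m ≡ n [MOD a ^ d] := by
  intro d
  induction d with
  | zero => intro m n _; simp [Nat.modEq_one]
  | succ d ih =>
    intro m n h
    have h0 := h 0 (by omega)
    simp only [pow_zero, Nat.div_one] at h0
    have h1 := ih (m / a) (n / a) (fun j hj => by
      have := h (j+1) (by omega)
      rwa [pow_succ', ← Nat.div_div_eq_div_mul, ← Nat.div_div_eq_div_mul] at this)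
    have h2 : a * (m / a) ≡ a * (n / a) [MOD a * a ^ d] := Nat.ModEq.mul_left' a h1
    have h3 : m % a = n % a := h0
    have h4 := h2.add_right (m % a)
    rw [Nat.div_add_mod, h3, Nat.div_add_mod] at h4
    rwa [pow_succ']

lemma grayH_eq_iff {a d : ℕ} (ha : 2 ≤ a) (m n : ℕ) :
    grayH a d m = grayH a d n ↔ m ≡ n [MOD a ^ d] := by
  constructor
  · intro h
    apply modEq_of_digits ha
    intro j hj
    exact (ZMod.natCast_eq_natCast_iff _ _ _).1 (grayH_digits h d j hj (by omega))
  · intro h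
    have key : ∀ x j, j < d → ((x / a ^ j : ℕ) : ZMod a) = ((x % a ^ d / a ^ j : ℕ) : ZMod a) := by
      intro x j hj
      have hp : 0 < a ^ j := by positivity
      obtain ⟨e, rfl⟩ : ∃ e, d = j + (e + 1) := ⟨d - j - 1, by omega⟩
      conv_lhs => rw [← Nat.mod_add_div x (a ^ (j + (e + 1)))]
      rw [pow_add, mul_assoc, Nat.add_mul_div_left _ _ hp]
      push_cast
      simp [pow_succ]
    funext j
    have h' : m % a ^ d = n % a ^ d := h
    simp only [grayH]
    congr 1
    · rw [key m j j.2, key n j j.2, h']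
    · split_ifs with hc
      · rw [key m _ hc, key n _ hc, h']
      · rfl

lemma grayH_adj {a d : ℕ} (hd : 1 ≤ d) (n : ℕ) :
    torusAdj a d (grayH a d n) (grayH a d (n+1)) := by
  classical
  let P : ℕ → Prop := fun j => j < d ∧ a ^ j ∣ n + 1
  have hP0 : P 0 := ⟨hd, by simp⟩
  obtain ⟨hk1, hk2⟩ : P (Nat.findGreatest P d) := Nat.findGreatest_spec (Nat.zero_le d) hP0
  have hk3 : ∀ j, P j → j ≤ Nat.findGreatest P d := fun j hj => Nat.le_findGreatest hj.1.le hj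
  generalize Nat.findGreatest P d = k at hk1 hk2 hk3
  refine ⟨⟨k, hk1⟩, ?_, Or.inl ?_⟩
  · intro j hj
    have hj' : (j : ℕ) ≠ k := fun h => hj (Fin.ext h)
    simp only [grayH, Nat.succ_div]
    rcases lt_or_gt_of_ne hj' with h | h
    · have h1 : a ^ (j : ℕ) ∣ n + 1 := (pow_dvd_pow a h.le).trans hk2
      have h2 : a ^ ((j : ℕ) + 1) ∣ n + 1 := (pow_dvd_pow a h).trans hk2
      have h3 : (j : ℕ) + 1 < d := by omega
      simp [h1, h2, h3]
    · have h1 : ¬ a ^ (j : ℕ) ∣ n + 1 := fun h1 => by have := hk3 j ⟨j.2, h1⟩; omega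
      by_cases h3 : (j : ℕ) + 1 < d
      · have h2 : ¬ a ^ ((j : ℕ) + 1) ∣ n + 1 := fun h2 => by have := hk3 _ ⟨h3, h2⟩; omega
        simp [h1, h2]
      · simp [h1, h3]
  · simp only [grayH, Nat.succ_div]
    by_cases h3 : k + 1 < d
    · have h2 : ¬ a ^ (k + 1) ∣ n + 1 := fun h2 => by have := hk3 _ ⟨h3, h2⟩; omega
      simp [hk2, h2, h3]; ring
    · simp [hk2, h3]

lemma modEq_close {M x y : ℕ} (h : x ≡ y [MOD M]) (h1 : x < y + M) (h2 : y < x + M) : x = y := by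
  rcases le_total x y with hxy | hxy
  · have := (Nat.modEq_iff_dvd' hxy).1 h
    have := Nat.eq_zero_of_dvd_of_lt this (by omega)
    omega
  · have := (Nat.modEq_iff_dvd' hxy).1 h.symm
    have := Nat.eq_zero_of_dvd_of_lt this (by omega)
    omega

/-- Segment of the Gray code. -/
def segPath {a d L : ℕ} (ha : 2 ≤ a) (hd : 1 ≤ d) (hLd : L ≤ a ^ d) (s : ℕ) : SAPath a d L where
  toFun i := grayH a d (s + i)
  inj := by
    intro i j hij
    have := modEq_close ((grayH_eq_iff ha _ _).1 hij) (by omega) (by omega)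
    exact Fin.ext (by omega)
  adj := fun i _ => grayH_adj hd (s + i)

def segPol {a d L : ℕ} (ha : 2 ≤ a) (hd : 1 ≤ d) (hLd : L ≤ a ^ d) (s : ℕ) : Polymer a d L :=
  Quotient.mk _ (segPath ha hd hLd s)

lemma mem_segPol {a d L : ℕ} (ha : 2 ≤ a) (hd : 1 ≤ d) (hLd : L ≤ a ^ d) (s : ℕ)
    (v : Fin d → ZMod a) :
    v ∈ (segPol ha hd hLd s).support ↔ ∃ i, i < L ∧ grayH a d (s + i) = v := by
  show v ∈ Set.range (segPath ha hd hLd s).toFun ↔ _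
  constructor
  · rintro ⟨i, rfl⟩; exact ⟨i, i.2, rfl⟩
  · rintro ⟨i, hi, rfl⟩; exact ⟨⟨i, hi⟩, rfl⟩

lemma segPol_disj {a d L N : ℕ} (ha : 2 ≤ a) (hd : 1 ≤ d) (hLd : L ≤ a ^ d)
    (hfull : N * L = a ^ d) (s k l : ℕ) (hk : k < N) (hl : l < N) (hkl : k ≠ l) :
    Disjoint (segPol ha hd hLd (s + k * L)).support (segPol ha hd hLd (s + l * L)).support := by
  rw [Set.disjoint_left]
  intro v h1 h2
  obtain ⟨i, hi, rfl⟩ := (mem_segPol ..).1 h1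
  obtain ⟨j, hj, h⟩ := (mem_segPol ..).1 h2
  have a1 : (k + 1) * L ≤ N * L := Nat.mul_le_mul_right _ hk
  have a2 : (l + 1) * L ≤ N * L := Nat.mul_le_mul_right _ hl
  rw [add_mul] at a1 a2
  have := modEq_close ((grayH_eq_iff ha _ _).1 h) (by omega) (by omega)
  rcases lt_or_gt_of_ne hkl with h3 | h3
  · have : (k + 1) * L ≤ l * L := Nat.mul_le_mul_right _ h3
    rw [add_mul] at this
    omega
  · have : (l + 1) * L ≤ k * L := Nat.mul_le_mul_right _ h3
    rw [add_mul] at this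
    omega

noncomputable def segConfig {a d L N : ℕ} (ha : 2 ≤ a) (hd : 1 ≤ d) (hL : 2 ≤ L)
    (hLd : L ≤ a ^ d) (hfull : N * L = a ^ d) (s : ℕ) : Config a d L N where
  polymers := (Finset.range N).image (fun k => segPol ha hd hLd (s + k * L))
  card_eq := by
    rw [Finset.card_image_of_injOn, Finset.card_range]
    intro k hk l hl hkl
    by_contra hne
    have hk : k < N := by simpa using hk
    have hl : l < N := by simpa using hl
    have hD := segPol_disj ha hd hLd hfull s k l hk hl hne
    simp only at hkl
    rw [hkl, Set.disjoint_left] at hD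
    have := (mem_segPol ha hd hLd (s + l * L) _).2 ⟨0, by omega, rfl⟩
    exact hD this this
  disj := by
    intro P hP Q hQ hne
    simp only [Finset.mem_image, Finset.mem_range] at hP hQ
    obtain ⟨k, hk, rfl⟩ := hP
    obtain ⟨l, hl, rfl⟩ := hQ
    exact segPol_disj ha hd hLd hfull s k l hk hl (fun h => hne (by rw [h]))

lemma support_ncard {a d L : ℕ} (P : Polymer a d L) : P.support.ncard = L := by
  induction P using Quotient.inductionOn with
  | _ p =>
    show (Set.range p.toFun).ncard = L
    rw [← Set.image_univ, Set.ncard_image_of_injective _ p.inj]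
    simp

lemma config_cover {a d L N : ℕ} (ha : 2 ≤ a) (hfull : N * L = a ^ d) (S : Config a d L N)
    (v : Fin d → ZMod a) : ∃ P ∈ S.polymers, v ∈ P.support := by
  classical
  haveI : NeZero a := ⟨by omega⟩
  have hc : (S.polymers.biUnion (fun P => P.support.toFinset)).card = N * L := by
    rw [Finset.card_biUnion]
    · rw [Finset.sum_congr rfl (fun P _ => by rw [← Set.ncard_eq_toFinset_card', support_ncard])]
      simp [S.card_eq]
    · intro P hP Q hQ hne
      simpa using S.disj P hP Q hQ hne
  have hu : S.polymers.biUnion (fun P => P.support.toFinset) = Finset.univ := by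
    rw [← Finset.card_eq_iff_eq_univ, hc, hfull]
    simp [ZMod.card]
  have := Finset.mem_univ v
  rw [← hu] at this
  simpa using this

lemma step_sub {a d L N : ℕ} (ha : 2 ≤ a) (hfull : N * L = a ^ d) (S S' : Config a d L N)
    (hc : (S.polymers \ S'.polymers).card ≤ 1) (Q P' : Polymer a d L)
    (hQ : Q ∈ S.polymers \ S'.polymers) (hP' : P' ∈ S'.polymers \ S.polymers) :
    P'.support ⊆ Q.support := by
  intro v hv
  obtain ⟨R, hR, hvR⟩ := config_cover ha hfull S v
  rw [Finset.mem_sdiff] at hP'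
  by_cases h : R ∈ S'.polymers
  · have hne : R ≠ P' := fun e => hP'.2 (e ▸ hR)
    exact absurd hv (Set.disjoint_left.1 (S'.disj R h P' hP'.1 hne) hvR)
  · have : R = Q := Finset.card_le_one.1 hc R (Finset.mem_sdiff.2 ⟨hR, h⟩) Q hQ
    exact this ▸ hvR

lemma step_inv {a d L N : ℕ} (ha : 2 ≤ a) (hN : 2 ≤ N) (hfull : N * L = a ^ d)
    (S S' : Config a d L N) (hadj : (configGraph a d L N).Adj S S')
    (T : Set (Fin d → ZMod a)) (h : ∃ P ∈ S.polymers, P.support = T) :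
    ∃ P ∈ S'.polymers, P.support = T := by
  obtain ⟨Q, hQ, rfl⟩ := h
  by_cases hQ' : Q ∈ S'.polymers
  · exact ⟨Q, hQ', rfl⟩
  have hI : (S.polymers ∩ S'.polymers).card = N - 1 := hadj.2
  have c1 := Finset.card_inter_add_card_sdiff S.polymers S'.polymers
  have c2 := Finset.card_inter_add_card_sdiff S'.polymers S.polymers
  rw [Finset.inter_comm] at c2
  rw [S.card_eq] at c1
  rw [S'.card_eq] at c2
  obtain ⟨P', hP'⟩ : (S'.polymers \ S.polymers).Nonempty := Finset.card_pos.1 (by omega)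
  have hQm := Finset.mem_sdiff.2 ⟨hQ, hQ'⟩
  exact ⟨P', (Finset.mem_sdiff.1 hP').1, subset_antisymm
    (step_sub ha hfull S S' (by omega) Q P' hQm hP')
    (step_sub ha hfull S' S (by omega) P' Q hP' hQm)⟩

/-- at density one (`N·L = a^d`, with `N, L ≥ 2`) the configuration graph is
not connected. -/
theorem configGraph_not_preconnected_of_density_one
    (a d L N : ℕ) (ha : 2 ≤ a) (hd : 1 ≤ d) (hN : 2 ≤ N) (hL : 2 ≤ L)
    (hfull : N * L = a ^ d) :
    ¬ (configGraph a d L N).Preconnected := by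
  intro hpre
  have h2L : 2 * L ≤ N * L := Nat.mul_le_mul_right _ hN
  have hLd : L ≤ a ^ d := by omega
  have walk : ∀ S S' : Config a d L N, (configGraph a d L N).Walk S S' →
      ∀ T, (∃ P ∈ S.polymers, P.support = T) → ∃ P ∈ S'.polymers, P.support = T := by
    intro S S' w
    induction w with
    | nil => intro T h; exact h
    | cons hadj _ ih => intro T h; exact ih T (step_inv ha hN hfull _ _ hadj T h)
  obtain ⟨w⟩ := hpre (segConfig ha hd hL hLd hfull 0) (segConfig ha hd hL hLd hfull 1)
  obtain ⟨P, hP, hPT⟩ := walk _ _ w (segPol ha hd hLd 0).support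
    ⟨segPol ha hd hLd 0, Finset.mem_image.2 ⟨0, by simp; omega, by simp⟩, rfl⟩
  obtain ⟨k, hk, rfl⟩ := Finset.mem_image.1 hP
  have hk : k < N := by simpa using hk
  have h1 : grayH a d 1 ∈ (segPol ha hd hLd 0).support :=
    (mem_segPol ..).2 ⟨1, by omega, rfl⟩
  have h0 : grayH a d 0 ∈ (segPol ha hd hLd 0).support :=
    (mem_segPol ..).2 ⟨0, by omega, rfl⟩
  rw [← hPT] at h1 h0
  obtain ⟨i, hi, hi'⟩ := (mem_segPol ..).1 h1
  obtain ⟨j, hj, hj'⟩ := (mem_segPol ..).1 h0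
  have a1 : (k + 1) * L ≤ N * L := Nat.mul_le_mul_right _ hk
  rw [add_mul] at a1
  have e1 := modEq_close ((grayH_eq_iff ha _ _).1 hi') (by omega) (by omega)
  have e2 := modEq_close ((grayH_eq_iff ha _ _).1 hj') (by omega) (by omega)
  omega
end

section
/- Fix integers a ≥ 2, d ≥ 1 and N ≥ 1 with 2·N < a^d (density ρ < 1). Then the configuration graph of N dimers (polymers of length L = 2) on the d-dimensional torus of side a is connected. -/
namespace DimerAux

open Finset

section abstract_part

variable {V E : Type} [DecidableEq V] [DecidableEq E]

def IsM (s : E → Finset V) (N : ℕ) (M : Finset E) : Prop :=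
  M.card = N ∧ ∀ P ∈ M, ∀ Q ∈ M, P ≠ Q → Disjoint (s P) (s Q)

def Step (s : E → Finset V) (N : ℕ) (M M' : Finset E) : Prop :=
  IsM s N M ∧ IsM s N M' ∧ (M = M' ∨ (M ∩ M').card = N - 1)

abbrev Reach (s : E → Finset V) (N : ℕ) := Relation.ReflTransGen (Step s N)

lemma step_symm {s : E → Finset V} {N : ℕ} {M M' : Finset E} (h : Step s N M M') :
    Step s N M' M := by
  refine ⟨h.2.1, h.1, ?_⟩
  rcases h.2.2 with h | h
  · exact Or.inl h.symm
  · right; rw [inter_comm]; exact h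

lemma reach_symm {s : E → Finset V} {N : ℕ} {M M' : Finset E} (h : Reach s N M M') :
    Reach s N M' M := by
  induction h with
  | refl => exact .refl
  | tail _ h ih => exact .head (step_symm h) ih

lemma uniq {s : E → Finset V} {N : ℕ} {M : Finset E} (hM : IsM s N M) {P Q : E}
    (hP : P ∈ M) (hQ : Q ∈ M) {x : V} (hx : x ∈ s P) (hx' : x ∈ s Q) : P = Q := by
  by_contra h
  exact (disjoint_left.1 (hM.2 P hP Q hQ h)) hx hx'

lemma swap {s : E → Finset V} (h2 : ∀ e, (s e).card = 2) {N : ℕ} {M : Finset E}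
    (hM : IsM s N M) {e e' : E} (he : e ∈ M)
    (hd : ∀ Q ∈ M, Q ≠ e → Disjoint (s e') (s Q)) :
    IsM s N (insert e' (M.erase e)) ∧ Reach s N M (insert e' (M.erase e)) := by
  have hne : e' ∉ M.erase e := by
    intro h
    have h1 := mem_erase.1 h
    have := hd e' h1.2 h1.1
    rw [disjoint_self] at this
    have h3 := h2 e'
    rw [this] at h3
    simp at h3
  have hpos : 0 < M.card := card_pos.2 ⟨e, he⟩
  have h1 : IsM s N (insert e' (M.erase e)) := by
    refine ⟨?_, ?_⟩
    · rw [card_insert_of_notMem hne, card_erase_of_mem he, ← hM.1]; omega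
    · intro P hP Q hQ hPQ
      rw [mem_insert, mem_erase] at hP hQ
      rcases hP with rfl | hP <;> rcases hQ with rfl | hQ
      · exact absurd rfl hPQ
      · exact hd Q hQ.2 hQ.1
      · exact (hd P hP.2 hP.1).symm
      · exact hM.2 P hP.2 Q hQ.2 hPQ
  refine ⟨h1, .single ⟨hM, h1, ?_⟩⟩
  by_cases hee : e' = e
  · left; subst hee; rw [insert_erase he]
  · right
    have : M ∩ insert e' (M.erase e) = M.erase e := by
      ext x
      simp only [mem_inter, mem_insert, mem_erase]
      constructor
      · rintro ⟨hx, rfl | h⟩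
        · exact ⟨hee, hx⟩
        · exact h
      · rintro ⟨h, h'⟩; exact ⟨h', Or.inr ⟨h, h'⟩⟩
    rw [this, card_erase_of_mem he, hM.1]

lemma diff_lt {M M' : Finset E} {e e' f : E} (he : e ∈ M \ M') (he' : e' ∉ M) :
    (insert f (M.erase e) \ insert f (M'.erase e')).card < (M \ M').card := by
  apply card_lt_card
  rw [ssubset_iff_of_subset]
  · refine ⟨e, he, ?_⟩
    simp only [mem_sdiff, mem_insert, mem_erase]
    tauto
  · intro x
    simp only [mem_sdiff, mem_insert, mem_erase]
    rintro ⟨h1, h2⟩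
    have : x ≠ e' → x ∉ M' := by tauto
    rcases h1 with h1 | h1
    · tauto
    · exact ⟨h1.2, this (fun h => he' (h ▸ h1.2))⟩

/-- choose an edge that we may replace by an edge `{h, w}`. -/
lemma pick {s : E → Finset V} {N : ℕ} {M M' : Finset E} (hM : IsM s N M) {w : V}
    (hno : ¬ ∃ e ∈ M, e ∈ M' ∧ w ∈ s e) (hne : (M \ M').Nonempty) :
    ∃ e ∈ M \ M', ∀ Q ∈ M, Q ≠ e → w ∉ s Q := by
  by_cases hc : ∃ e ∈ M, w ∈ s e
  · obtain ⟨e, he, hw⟩ := hc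
    refine ⟨e, mem_sdiff.2 ⟨he, fun h => hno ⟨e, he, h, hw⟩⟩, ?_⟩
    intro Q hQ hQe hwQ
    exact hQe (uniq hM hQ he hwQ hw)
  · obtain ⟨e, he⟩ := hne
    exact ⟨e, he, fun Q hQ _ hw => hc ⟨Q, hQ, hw⟩⟩

lemma pair_disj {s : E → Finset V} {f : E} {h w : V} (hf : s f = {h, w}) {Q : E}
    (hh : h ∉ s Q) (hw : w ∉ s Q) : Disjoint (s f) (s Q) := by
  rw [hf, disjoint_left]
  intro x hx
  rw [mem_insert, mem_singleton] at hx
  rcases hx with rfl | rfl <;> assumption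

lemma other {s : E → Finset V} (h2 : ∀ e, (s e).card = 2) {e : E} {h : V} (hh : h ∈ s e) :
    ∃ w, w ≠ h ∧ s e = {h, w} := by
  obtain ⟨x, y, hxy, hs⟩ := card_eq_two.1 (h2 e)
  rw [hs, mem_insert, mem_singleton] at hh
  rcases hh with rfl | rfl
  · exact ⟨y, hxy.symm, hs⟩
  · exact ⟨x, hxy, by rw [hs, pair_comm]⟩

open Classical in
lemma inner {s : E → Finset V} (h2 : ∀ e, (s e).card = 2) {N : ℕ} (k : ℕ)
    (IH : ∀ M M' : Finset E, IsM s N M → IsM s N M' → (M \ M').card < k → Reach s N M M')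
    (v : V) (F : Set E) (hF : ∀ P ∈ F, ∀ Q ∈ F, P ≠ Q → Disjoint (s P) (s Q))
    (hFc : ∀ h, h ≠ v → ∃ e ∈ F, h ∈ s e) (m : ℕ) :
    ∀ M M' : Finset E, IsM s N M → IsM s N M' → (M \ M').card ≤ k →
      (∃ e ∈ M \ M', v ∈ s e) → (∃ h, (∀ e ∈ M, h ∉ s e) ∧ (∀ e ∈ M', h ∉ s e)) →
      (M.filter (fun e => e ∉ F)).card ≤ m → Reach s N M M' := by
  induction m with
  | zero | succ m ihm =>
    intro M M' hM hM' hk hv ⟨h, hh, hh'⟩ hm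
    obtain ⟨e0, he0, hve0⟩ := hv
    have he0' := mem_sdiff.1 he0
    have hhv : h ≠ v := fun hc => hh e0 he0'.1 (hc ▸ hve0)
    obtain ⟨f, hfF, hhf⟩ := hFc h hhv
    obtain ⟨w, hwh, hsf⟩ := other h2 hhf
    by_cases hc : ∃ e ∈ M, e ∈ M' ∧ w ∈ s e
    · obtain ⟨e, heM, heM', hwe⟩ := hc
      have heF : e ∉ F := by
        intro heF
        have hef : e ≠ f := by
          rintro rfl; exact hh _ heM hhf
        exact disjoint_left.1 (hF e heF f hfF hef) hwe (by rw [hsf]; simp)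
      have hlt : ((insert f (M.erase e)).filter (fun e => e ∉ F)).card
          < (M.filter (fun e => e ∉ F)).card := by
        apply card_lt_card
        rw [ssubset_iff_of_subset]
        · refine ⟨e, by simp [heM, heF], ?_⟩
          simp only [mem_filter, mem_insert, mem_erase]
          rintro ⟨h1 | h1, h2⟩
          · exact h2 (h1 ▸ hfF)
          · exact h1.1 rfl
        · intro x
          simp only [mem_filter, mem_insert, mem_erase]
          rintro ⟨h1 | h1, h2⟩
          · exact absurd (h1 ▸ hfF) h2
          · exact ⟨h1.2, h2⟩
      first
      | (exfalso; omega)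
      | skip
        have hs1 := swap h2 hM heM (e' := f) (fun Q hQ hQe => pair_disj hsf (hh Q hQ)
          (fun hw => hQe (uniq hM hQ heM hw hwe)))
        have hs2 := swap h2 hM' heM' (e' := f) (fun Q hQ hQe => pair_disj hsf (hh' Q hQ)
          (fun hw => hQe (uniq hM' hQ heM' hw hwe)))
        refine hs1.2.trans (Relation.ReflTransGen.trans ?_ (reach_symm hs2.2))
        refine ihm _ _ hs1.1 hs2.1 ?_ ?_ ?_ (by omega)
        · refine le_trans (card_le_card ?_) hk
          intro x
          simp only [mem_sdiff, mem_insert, mem_erase]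
          tauto
        · refine ⟨e0, ?_, hve0⟩
          have h1 : e0 ≠ f := by
            rintro rfl; exact hh _ he0'.1 hhf
          have h3 : e0 ≠ e := by
            rintro rfl; exact he0'.2 heM'
          simp only [mem_sdiff, mem_insert, mem_erase]
          tauto
        · obtain ⟨x, hxw, hse⟩ := other h2 hwe
          have hxe : x ∈ s e := by rw [hse]; simp
          have hxf : x ∉ s f := by
            rw [hsf]; simp only [mem_insert, mem_singleton, not_or]
            refine ⟨?_, hxw⟩
            rintro rfl; exact hh e heM hxe
          refine ⟨x, ?_, ?_⟩
          · intro Q hQ hxQ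
            rw [mem_insert, mem_erase] at hQ
            rcases hQ with rfl | hQ
            · exact hxf hxQ
            · exact hQ.1 (uniq hM hQ.2 heM hxQ hxe)
          · intro Q hQ hxQ
            rw [mem_insert, mem_erase] at hQ
            rcases hQ with rfl | hQ
            · exact hxf hxQ
            · exact hQ.1 (uniq hM' hQ.2 heM' hxQ hxe)
    · have hne' : (M' \ M).Nonempty := by
        rw [← card_pos]
        have h1 : 0 < (M \ M').card := card_pos.2 ⟨e0, he0⟩
        have h3 := card_sdiff_add_card_inter M M'
        have h4 := card_sdiff_add_card_inter M' M
        rw [inter_comm] at h4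
        have := hM.1
        have := hM'.1
        omega
      obtain ⟨e1, he1, hq1⟩ := pick hM hc ⟨e0, he0⟩
      obtain ⟨e2, he2, hq2⟩ := pick hM' (w := w) (M' := M)
        (fun ⟨e, a, b, c⟩ => hc ⟨e, b, a, c⟩) hne'
      have hs1 := swap h2 hM (mem_sdiff.1 he1).1 (e' := f)
        (fun Q hQ hQe => pair_disj hsf (hh Q hQ) (hq1 Q hQ hQe))
      have hs2 := swap h2 hM' (mem_sdiff.1 he2).1 (e' := f)
        (fun Q hQ hQe => pair_disj hsf (hh' Q hQ) (hq2 Q hQ hQe))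
      refine hs1.2.trans (Relation.ReflTransGen.trans ?_ (reach_symm hs2.2))
      exact IH _ _ hs1.1 hs2.1 (lt_of_lt_of_le (diff_lt he1 (mem_sdiff.1 he2).2) hk)

lemma card_cover {s : E → Finset V} (h2 : ∀ e, (s e).card = 2) {N : ℕ} {M : Finset E}
    (hM : IsM s N M) : (M.biUnion s).card = 2 * N := by
  rw [card_biUnion (fun P hP Q hQ h => hM.2 P hP Q hQ h), sum_congr rfl (fun e _ => h2 e)]
  simp [hM.1, mul_comm]

theorem main [Fintype V] {s : E → Finset V} (h2 : ∀ e, (s e).card = 2) {N : ℕ}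
    (hF : ∀ v : V, ∃ F : Set E, (∀ P ∈ F, ∀ Q ∈ F, P ≠ Q → Disjoint (s P) (s Q)) ∧
      ∀ h, h ≠ v → ∃ e ∈ F, h ∈ s e)
    (hcard : 2 * N < Fintype.card V) (k : ℕ) :
    ∀ M M' : Finset E, IsM s N M → IsM s N M' → (M \ M').card < k → Reach s N M M' := by
  induction k with
  | zero => intro M M' _ _ h; omega
  | succ k ih =>
    intro M M' hM hM' hk
    by_cases hemp : (M \ M') = ∅
    · have : M = M' := eq_of_subset_of_card_le (sdiff_eq_empty_iff_subset.1 hemp)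
        (by rw [hM.1, hM'.1])
      rw [this]
    obtain ⟨e0, he0⟩ := nonempty_iff_ne_empty.2 hemp
    by_cases hsub : M'.biUnion s ⊆ M.biUnion s
    · have heq : M'.biUnion s = M.biUnion s := eq_of_subset_of_card_le hsub
        (by rw [card_cover h2 hM, card_cover h2 hM'])
      obtain ⟨h, hh⟩ : ∃ h, h ∉ M.biUnion s := by
        by_contra! hc
        have : M.biUnion s = univ := eq_univ_iff_forall.2 hc
        have h3 := card_cover h2 hM
        rw [this, card_univ] at h3
        omega
      have hh' := hh
      rw [← heq] at hh'
      obtain ⟨v, hv⟩ : (s e0).Nonempty := card_pos.1 (by rw [h2]; norm_num)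
      obtain ⟨F, hF1, hF2⟩ := hF v
      refine inner h2 k ih v F hF1 hF2 _ M M' hM hM' (by omega) ⟨e0, he0, hv⟩
        ⟨h, ?_, ?_⟩ le_rfl
      · intro e he hhe; exact hh (mem_biUnion.2 ⟨e, he, hhe⟩)
      · intro e he hhe; exact hh' (mem_biUnion.2 ⟨e, he, hhe⟩)
    · obtain ⟨v, hv, hv'⟩ := not_subset.1 hsub
      obtain ⟨f, hfM', hvf⟩ := mem_biUnion.1 hv
      have hvM : ∀ e ∈ M, v ∉ s e := fun e he h => hv' (mem_biUnion.2 ⟨e, he, h⟩)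
      obtain ⟨w, hwv, hsf⟩ := other h2 hvf
      have hno : ¬ ∃ e ∈ M, e ∈ M' ∧ w ∈ s e := by
        rintro ⟨e, he, he', hwe⟩
        have : e = f := uniq hM' he' hfM' hwe (by rw [hsf]; simp)
        subst this
        exact hvM _ he hvf
      obtain ⟨e1, he1, hq⟩ := pick hM hno ⟨e0, he0⟩
      have hs1 := swap h2 hM (mem_sdiff.1 he1).1 (e' := f)
        (fun Q hQ hQe => pair_disj hsf (hvM Q hQ) (hq Q hQ hQe))
      refine hs1.2.trans (ih _ _ hs1.1 hM' ?_)
      have := diff_lt (f := f) he1 (e' := f) (fun h => hvM _ h hvf)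
      rw [insert_erase hfM'] at this
      omega

end abstract_part

section torus

lemma even_g (a : ℕ) (ha : 2 ≤ a) (he : a % 2 = 0) : ∃ g : ZMod a → ZMod a,
    ∀ t, g (g t) = t ∧ (g t = t + 1 ∨ g t = t - 1) := by
  haveI : NeZero a := ⟨by omega⟩
  refine ⟨fun t => ((if t.val % 2 = 0 then t.val + 1 else t.val - 1 : ℕ) : ZMod a), ?_⟩
  intro t
  have ht := ZMod.val_lt t
  have htc : ((t.val : ℕ) : ZMod a) = t := ZMod.natCast_zmod_val t
  by_cases h : t.val % 2 = 0
  · have hv : ((t.val + 1 : ℕ) : ZMod a).val = t.val + 1 := ZMod.val_cast_of_lt (by omega)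
    have h1 : ¬ (t.val + 1) % 2 = 0 := by omega
    simp only [if_pos h, hv, if_neg h1]
    refine ⟨by simpa using htc, Or.inl (by push_cast; rw [htc])⟩
  · have hv : ((t.val - 1 : ℕ) : ZMod a).val = t.val - 1 := ZMod.val_cast_of_lt (by omega)
    have h1 : (t.val - 1) % 2 = 0 := by omega
    have h2 : t.val - 1 + 1 = t.val := by omega
    simp only [if_neg h, hv, if_pos h1, h2]
    refine ⟨htc, Or.inr ?_⟩
    rw [Nat.cast_sub (by omega), htc, Nat.cast_one]

lemma odd_g (a : ℕ) (ha : 2 ≤ a) (he : a % 2 = 1) : ∃ g : ZMod a → ZMod a,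
    ∀ t, t ≠ 0 → g (g t) = t ∧ (g t = t + 1 ∨ g t = t - 1) ∧ g t ≠ 0 := by
  haveI : NeZero a := ⟨by omega⟩
  refine ⟨fun t => ((if t.val % 2 = 1 then t.val + 1 else t.val - 1 : ℕ) : ZMod a), ?_⟩
  intro t ht0
  have ht := ZMod.val_lt t
  have ht0' : t.val ≠ 0 := by rwa [Ne, ZMod.val_eq_zero]
  have htc : ((t.val : ℕ) : ZMod a) = t := ZMod.natCast_zmod_val t
  by_cases h : t.val % 2 = 1
  · have hv : ((t.val + 1 : ℕ) : ZMod a).val = t.val + 1 := ZMod.val_cast_of_lt (by omega)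
    have h1 : ¬ (t.val + 1) % 2 = 1 := by omega
    simp only [if_pos h, hv, if_neg h1]
    refine ⟨by simpa using htc, Or.inl (by push_cast; rw [htc]), ?_⟩
    rw [Ne, ← ZMod.val_eq_zero, hv]; omega
  · have hv : ((t.val - 1 : ℕ) : ZMod a).val = t.val - 1 := ZMod.val_cast_of_lt (by omega)
    have h1 : (t.val - 1) % 2 = 1 := by omega
    have h2 : t.val - 1 + 1 = t.val := by omega
    simp only [if_neg h, hv, if_pos h1, h2]
    refine ⟨htc, Or.inr ?_, ?_⟩
    · rw [Nat.cast_sub (by omega), htc, Nat.cast_one]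
    · rw [Ne, ← ZMod.val_eq_zero, hv]; omega

lemma adj_update (a d : ℕ) (x : Fin d → ZMod a) (i : Fin d) (t : ZMod a)
    (h : t = x i + 1 ∨ t = x i - 1) : torusAdj a d x (Function.update x i t) := by
  refine ⟨i, fun j hj => by rw [Function.update_of_ne hj], ?_⟩
  rw [Function.update_self]; exact h

lemma exists_invol (a d : ℕ) (ha : 2 ≤ a) (hd : 1 ≤ d) (v : Fin d → ZMod a) :
    ∃ f : (Fin d → ZMod a) → (Fin d → ZMod a), ∀ x, x ≠ v →
      f (f x) = x ∧ torusAdj a d x (f x) := by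
  rcases Nat.mod_two_eq_zero_or_one a with he | ho
  · obtain ⟨g, hg⟩ := even_g a ha he
    let i : Fin d := ⟨0, hd⟩
    refine ⟨fun x => Function.update x i (g (x i)), fun x _ => ⟨?_, ?_⟩⟩
    · simp [(hg (x i)).1]
    · exact adj_update a d x i _ (hg (x i)).2
  · obtain ⟨g, hg⟩ := odd_g a ha ho
    have key : ∀ x : Fin d → ZMod a, x ≠ v → ∃ i, x i ≠ v i ∧ ∀ j, j < i → x j = v j := by
      intro x hx
      have hne : (Finset.univ.filter (fun i => x i ≠ v i)).Nonempty := by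
        obtain ⟨i, hi⟩ := Function.ne_iff.1 hx
        exact ⟨i, by simp [hi]⟩
      refine ⟨_, (Finset.mem_filter.1 (Finset.min'_mem _ hne)).2, ?_⟩
      intro j hj
      by_contra hc
      exact absurd (Finset.min'_le _ j (by simp [hc])) (not_le.2 hj)
    classical
    haveI : Nonempty (Fin d) := ⟨⟨0, hd⟩⟩
    choose! idx h1 h2 using key
    have huniq : ∀ x i, x i ≠ v i → (∀ j, j < i → x j = v j) → idx x = i := by
      intro x i hi hj
      have hx : x ≠ v := fun h => hi (by rw [h])
      rcases lt_trichotomy (idx x) i with h | h | h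
      · exact absurd (hj _ h) (h1 x hx)
      · exact h
      · exact absurd (h2 x hx _ h) hi
    refine ⟨fun x => Function.update x (idx x) (v (idx x) + g (x (idx x) - v (idx x))), ?_⟩
    intro x hx
    have ht : x (idx x) - v (idx x) ≠ 0 := sub_ne_zero.2 (h1 x hx)
    obtain ⟨g1, g2, g3⟩ := hg _ ht
    have hidx : idx (Function.update x (idx x) (v (idx x) + g (x (idx x) - v (idx x)))) = idx x := by
      apply huniq
      · rw [Function.update_self]
        intro h; exact g3 (by simpa using h)
      · intro j hj
        rw [Function.update_of_ne hj.ne]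
        exact h2 x hx j hj
    refine ⟨?_, ?_⟩
    · simp only [hidx, Function.update_self, add_sub_cancel_left, g1, Function.update_idem]
      simp
    · apply adj_update
      rcases g2 with h | h
      · left; rw [h]; ring
      · right; rw [h]; ring

lemma adj_ne {a d : ℕ} (ha : 2 ≤ a) {x y : Fin d → ZMod a} (h : torusAdj a d x y) : x ≠ y := by
  haveI : Fact (1 < a) := ⟨by omega⟩
  rintro rfl
  obtain ⟨i, -, h | h⟩ := h
  · simp at h
  · have : (1 : ZMod a) = 0 := by
      have h' := sub_eq_self.1 h.symm
      exact h'
    exact one_ne_zero this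

lemma exists_polymer {a d : ℕ} (ha : 2 ≤ a) {x y : Fin d → ZMod a} (h : torusAdj a d x y) :
    ∃ P : Polymer a d 2, P.support = {x, y} := by
  have hne := adj_ne ha h
  refine ⟨Quotient.mk _ ⟨![x, y], ?_, ?_⟩, ?_⟩
  · intro i j hij
    fin_cases i <;> fin_cases j <;> simp_all
  · intro i hi
    obtain rfl : i = 0 := by omega
    exact h
  · show Set.range ![x, y] = {x, y}
    simp [Matrix.range_cons, Set.pair_comm]

lemma polymer_supp {a d : ℕ} (P : Polymer a d 2) : ∃ x y, x ≠ y ∧ P.support = {x, y} := by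
  induction P using Quotient.inductionOn with
  | h p =>
    refine ⟨p.toFun 0, p.toFun 1, fun h => by simpa using p.inj h, ?_⟩
    show Set.range p.toFun = _
    ext z
    simp [Fin.exists_fin_two, eq_comm]

lemma polymer_inj {a d : ℕ} (P Q : Polymer a d 2) (h : P.support = Q.support) : P = Q := by
  induction P using Quotient.inductionOn with
  | h p =>
  induction Q using Quotient.inductionOn with
  | h q =>
    apply Quotient.sound
    change Set.range p.toFun = Set.range q.toFun at h
    show q.toFun = p.toFun ∨ q.toFun = p.toFun ∘ Fin.rev
    have hq : q.toFun 0 ≠ q.toFun 1 := fun h => by simpa using q.inj h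
    have h0 : q.toFun 0 ∈ Set.range p.toFun := h ▸ Set.mem_range_self 0
    have h1 : q.toFun 1 ∈ Set.range p.toFun := h ▸ Set.mem_range_self 1
    simp only [Set.mem_range, Fin.exists_fin_two] at h0 h1
    rcases h0 with h0 | h0 <;> rcases h1 with h1 | h1
    · exact absurd (h0.symm.trans h1) hq
    · left; funext i; fin_cases i <;> simp [h0, h1]
    · right; funext i; fin_cases i
      · exact h0.symm
      · exact h1.symm
    · exact absurd (h0.symm.trans h1) hq

end torus

end DimerAux

open DimerAux in
/-- at density `< 1`, the configuration graph of `N` dimers (polymers of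
length `2`) on the `d`-dimensional torus of side `a` is connected. -/
theorem dimer_configGraph_preconnected
    (a d N : ℕ) (ha : 2 ≤ a) (hd : 1 ≤ d) (hN : 1 ≤ N)
    (hdens : 2 * N < a ^ d) :
    (configGraph a d 2 N).Preconnected := by
  classical
  haveI : NeZero a := ⟨by omega⟩
  let s : Polymer a d 2 → Finset (Fin d → ZMod a) := fun P => P.support.toFinset
  have hs : ∀ P x, x ∈ s P ↔ x ∈ P.support := fun P x => Set.mem_toFinset
  have hdj : ∀ P Q, Disjoint (s P) (s Q) ↔ Disjoint P.support Q.support :=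
    fun P Q => Set.disjoint_toFinset
  have h2 : ∀ P, (s P).card = 2 := by
    intro P
    obtain ⟨x, y, hxy, h⟩ := polymer_supp P
    have : s P = {x, y} := by ext z; rw [hs, h]; simp
    rw [this, Finset.card_pair hxy]
  have hF : ∀ v : Fin d → ZMod a, ∃ F : Set (Polymer a d 2),
      (∀ P ∈ F, ∀ Q ∈ F, P ≠ Q → Disjoint (s P) (s Q)) ∧
      ∀ h, h ≠ v → ∃ e ∈ F, h ∈ s e := by
    intro v
    obtain ⟨f, hf⟩ := exists_invol a d ha hd v
    refine ⟨{P | ∃ x, f (f x) = x ∧ P.support = {x, f x}}, ?_, ?_⟩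
    · rintro P ⟨x, hx, hP⟩ Q ⟨y, hy, hQ⟩ hPQ
      rw [hdj, Set.disjoint_left]
      intro z hz hz'
      apply hPQ
      apply polymer_inj
      rw [hP] at hz ⊢
      rw [hQ] at hz' ⊢
      have e1 : ({x, f x} : Set (Fin d → ZMod a)) = {z, f z} := by
        rcases hz with rfl | rfl
        · rfl
        · rw [hx, Set.pair_comm]
      have e2 : ({y, f y} : Set (Fin d → ZMod a)) = {z, f z} := by
        rcases hz' with rfl | rfl
        · rfl
        · rw [hy, Set.pair_comm]
      rw [e1, e2]
    · intro h hh
      obtain ⟨P, hP⟩ := exists_polymer ha (hf h hh).2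
      exact ⟨P, ⟨h, (hf h hh).1, hP⟩, by rw [hs, hP]; simp⟩
  have hcard : 2 * N < Fintype.card (Fin d → ZMod a) := by
    simpa [ZMod.card] using hdens
  have hC : ∀ C : Config a d 2 N, IsM s N C.polymers := fun C =>
    ⟨C.card_eq, fun P hP Q hQ h => (hdj P Q).2 (C.disj P hP Q hQ h)⟩
  have hext : ∀ C C' : Config a d 2 N, C.polymers = C'.polymers → C = C' := by
    rintro ⟨p, _, _⟩ ⟨q, _, _⟩ h
    cases h; rfl
  have hreach : ∀ (C : Config a d 2 N) (M : Finset (Polymer a d 2)),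
      Reach s N C.polymers M →
        ∀ C' : Config a d 2 N, C'.polymers = M → (configGraph a d 2 N).Reachable C C' := by
    intro C M h
    induction h with
    | refl => intro C' h; rw [hext _ _ h]
    | @tail M1 M2 _ hst ih =>
      intro C' hC'
      let D : Config a d 2 N := ⟨M1, hst.1.1, fun P hP Q hQ h =>
        (hdj P Q).1 (hst.1.2 P hP Q hQ h)⟩
      refine (ih D rfl).trans ?_
      by_cases hDC : D = C'
      · rw [hDC]
      · apply SimpleGraph.Adj.reachable
        refine ⟨hDC, ?_⟩
        rcases hst.2.2 with h | h
        · exact absurd (hext _ _ (by rw [hC']; exact h)) hDC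
        · rw [hC']
          convert h
  intro C C'
  refine hreach C _ ?_ C' rfl
  exact main h2 hF hcard _ _ _ (hC C) (hC C') (Nat.lt_succ_self _)
end

section
/- Let a ≥ 3 be an odd integer, and let M be a set of dimers on the two-dimensional torus of side a whose supports are pairwise disjoint and cover all vertices except a single free vertex v₀. For every r ∈ ZMod a with r different from the second coordinate of v₀ (so that the row {(x, r) : x ∈ ZMod a} is entirely covered by M), the number of dimers of M having exactly one endpoint in that row is odd; in particular there is at least one vertical dimer (a dimer whose endpoints differ in the second coordinate) meeting that row. -/
/-- Two vertices of the two-dimensional torus of side `a` are adjacent iff they agree in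
exactly one coordinate and differ by `+1` or `-1` (in `ZMod a`) in the other. -/
def adj2 (a : ℕ) (u v : ZMod a × ZMod a) : Prop :=
  (u.1 = v.1 ∧ u.2 ≠ v.2 ∧ (v.2 = u.2 + 1 ∨ v.2 = u.2 - 1)) ∨
  (u.2 = v.2 ∧ u.1 ≠ v.1 ∧ (v.1 = u.1 + 1 ∨ v.1 = u.1 - 1))

/-- A dimer: an unordered pair of adjacent vertices. -/
def IsDimer (a : ℕ) (e : Sym2 (ZMod a × ZMod a)) : Prop :=
  ∃ u v : ZMod a × ZMod a, adj2 a u v ∧ e = s(u, v)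

open scoped Classical in
/-- let `a ≥ 3` be odd and let `M` be a set of pairwise disjoint dimers
covering all vertices of the two-dimensional torus of side `a` except a single free vertex
`v₀`.  For every row `r ≠ v₀.2` (which is entirely covered by `M`), the number of dimers of
`M` with exactly one endpoint in row `r` is odd; in particular some vertical dimer meets
row `r`. -/
theorem odd_number_of_vertical_dimers_meeting_full_row
    (a : ℕ) (ha : 3 ≤ a) (hodd : Odd a)
    (M : Finset (Sym2 (ZMod a × ZMod a)))
    (hdim : ∀ e ∈ M, IsDimer a e)
    (v₀ : ZMod a × ZMod a)
    (hdisj : ∀ e ∈ M, ∀ f ∈ M, e ≠ f → ∀ x : ZMod a × ZMod a, x ∈ e → x ∉ f)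
    (hcover : ∀ x : ZMod a × ZMod a, x ≠ v₀ → ∃ e ∈ M, x ∈ e)
    (hfree : ∀ e ∈ M, v₀ ∉ e)
    (r : ZMod a) (hr : r ≠ v₀.2) :
    Odd (M.filter
        (fun e => ∃ u v : ZMod a × ZMod a, e = s(u, v) ∧ u.2 = r ∧ v.2 ≠ r)).card ∧
      ∃ e ∈ M, (∃ u v : ZMod a × ZMod a, e = s(u, v) ∧ u.2 ≠ v.2) ∧
        ∃ u ∈ e, u.2 = r := by
  have : NeZero a := ⟨by omega⟩
  have hO : Odd (M.filter
        (fun e => ∃ u v : ZMod a × ZMod a, e = s(u, v) ∧ u.2 = r ∧ v.2 ≠ r)).card := by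
    set R : Finset (ZMod a × ZMod a) := Finset.univ.image (fun x : ZMod a => (x, r)) with hR
    have hRmem : ∀ x : ZMod a × ZMod a, x ∈ R ↔ x.2 = r := by
      rintro ⟨x, y⟩
      simp [hR, eq_comm]
    have hRcard : R.card = a := by
      rw [hR, Finset.card_image_of_injective _ (fun x y h => (Prod.mk.inj h).1)]
      simp [ZMod.card]
    have h1 : ∀ x ∈ R, (M.filter (fun e => x ∈ e)).card = 1 := by
      intro x hx
      rw [hRmem] at hx
      obtain ⟨e, he, hxe⟩ := hcover x (by rintro rfl; exact hr hx.symm)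
      rw [Finset.card_eq_one]
      refine ⟨e, ?_⟩
      ext f
      simp only [Finset.mem_filter, Finset.mem_singleton]
      constructor
      · rintro ⟨hf, hxf⟩
        by_contra hne
        exact hdisj f hf e he hne x hxf hxe
      · rintro rfl
        exact ⟨he, hxe⟩
    have h2 : ∑ x ∈ R, (M.filter (fun e => x ∈ e)).card
        = ∑ e ∈ M, (R.filter (fun x => x ∈ e)).card :=
      Finset.sum_card_bipartiteAbove_eq_sum_card_bipartiteBelow (fun x e => x ∈ e)
    rw [Finset.sum_congr rfl h1] at h2
    simp only [Finset.sum_const, hRcard, smul_eq_mul, mul_one] at h2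
    have h3 : ∀ e ∈ M, (((R.filter (fun x => x ∈ e)).card : ℕ) : ZMod 2) =
        if (∃ u v : ZMod a × ZMod a, e = s(u, v) ∧ u.2 = r ∧ v.2 ≠ r) then 1 else 0 := by
      intro e he
      obtain ⟨u, v, huv, rfl⟩ := hdim e he
      have hne : u ≠ v := by
        rintro rfl
        rcases huv with h | h
        · exact h.2.1 rfl
        · exact h.2.1 rfl
      have hP : (∃ u' v' : ZMod a × ZMod a, s(u, v) = s(u', v') ∧ u'.2 = r ∧ v'.2 ≠ r) ↔
          ((u.2 = r ∧ v.2 ≠ r) ∨ (v.2 = r ∧ u.2 ≠ r)) := by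
        constructor
        · rintro ⟨u', v', h, h4, h5⟩
          rcases Sym2.eq_iff.1 h with ⟨rfl, rfl⟩ | ⟨rfl, rfl⟩
          · exact Or.inl ⟨h4, h5⟩
          · exact Or.inr ⟨h4, h5⟩
        · rintro (h | h)
          · exact ⟨u, v, rfl, h⟩
          · exact ⟨v, u, Sym2.eq_swap, h⟩
      have hF : R.filter (fun x => x ∈ s(u, v)) =
          ({u, v} : Finset (ZMod a × ZMod a)).filter (fun x => x.2 = r) := by
        ext x
        simp only [Finset.mem_filter, hRmem, Sym2.mem_iff, Finset.mem_insert,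
          Finset.mem_singleton]
        tauto
      rw [hF, if_congr hP rfl rfl]
      by_cases hu : u.2 = r <;> by_cases hv : v.2 = r <;>
        simp [Finset.filter_insert, Finset.filter_singleton, hu, hv, hne]
      rfl
    rw [← ZMod.natCast_eq_one_iff_odd, Finset.card_filter]
    push_cast
    rw [← Finset.sum_congr rfl h3, ← Nat.cast_sum, ← h2]
    exact ZMod.natCast_eq_one_iff_odd.2 hodd
  refine ⟨by convert hO, ?_⟩
  obtain ⟨e, he⟩ := Finset.card_pos.1 hO.pos
  obtain ⟨heM, u, v, rfl, hu, hv⟩ := Finset.mem_filter.1 he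
  exact ⟨s(u, v), heM, ⟨u, v, rfl, by rw [hu]; exact hv.symm⟩, u, Sym2.mem_mk_left u v, hu⟩
end

section
/- Let n ≥ 1 be an integer, and set a = 9n, d = 2, L = 5 and N = 16n² (so the density is 5N/a² = 80/81). Then the configuration graph of N polymers of length 5 on the two-dimensional torus of side a is not connected. -/
namespace Pol

def tbl : List ℕ := [80, 7, 6, 5, 38, 44, 19, 18, 17, 12, 8, 31, 30, 39, 26, 25, 10, 11, 13, 9, 32, 29, 28, 27, 22, 21, 20, 14, 50, 33, 66, 67, 68, 23, 55, 56, 58, 51, 34, 65, 70, 69, 24, 60, 57, 59, 52, 53, 54, 71, 63, 62, 61, 45, 0, 75, 74, 73, 72, 64, 40, 47, 46, 1, 76, 77, 78, 36, 35, 41, 48, 15, 2, 3, 4, 79, 37, 43, 42, 49, 16]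

def T (x y : ZMod 9) : ℕ := tbl.getD (9 * x.val + y.val) 80

def ox : Fin 16 → Fin 5 → ℤ :=
  ![![-2, -1, 0, 0, 0],
    ![0, 0, 0, 1, 2],
    ![0, 0, 0, 1, 2],
    ![-2, -1, 0, 0, 0],
    ![0, 0, 0, 1, 2],
    ![-1, -1, 0, 0, 0],
    ![-1, -1, 0, 1, 2],
    ![-1, -1, 0, 1, 2],
    ![-2, -1, 0, 0, 1],
    ![-1, 0, 0, 1, 2],
    ![-2, -1, 0, 0, 0],
    ![-1, -1, 0, 0, 1],
    ![-1, 0, 0, 0, 1],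
    ![1, 0, 0, 0, 1],
    ![-2, -1, 0, 0, 0],
    ![-1, 0, 0, 0, 1]]

def oy : Fin 16 → Fin 5 → ℤ :=
  ![![0, 0, 0, 1, 2],
    ![2, 1, 0, 0, 0],
    ![-2, -1, 0, 0, 0],
    ![0, 0, 0, -1, -2],
    ![2, 1, 0, 0, 0],
    ![1, 0, 0, -1, -2],
    ![1, 0, 0, 0, 0],
    ![1, 0, 0, 0, 0],
    ![0, 0, 0, -1, -1],
    ![1, 1, 0, 0, 0],
    ![0, 0, 0, 1, 2],
    ![-1, 0, 0, 1, 1],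
    ![1, 1, 0, -1, -1],
    ![-1, -1, 0, 1, 1],
    ![0, 0, 0, -1, -2],
    ![-1, -1, 0, 1, 1]]

def mx : Fin 16 → ℕ := ![8, 0, 1, 0, 2, 2, 2, 8, 8, 6, 5, 4, 5, 3, 6, 7]

def my : Fin 16 → ℕ := ![0, 1, 0, 8, 6, 5, 2, 4, 6, 7, 1, 8, 6, 4, 4, 2]

def fc (t : ℕ) : Fin 6 := if t = 80 then 5 else Fin.ofNat 6 (t % 5)

def ok (a b : Fin 6) : Bool :=
  (a.val == 5 && b.val == 2) || (a.val == 2 && b.val == 5) ||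
  (a.val < 5 && b.val < 5 && (a.val + 1 == b.val || b.val + 1 == a.val))

theorem ok_symm : ∀ a b, ok a b = true → ok b a = true := by decide

theorem F1 : ∀ k i, T ((mx k : ZMod 9) + (ox k i : ZMod 9)) ((my k : ZMod 9) + (oy k i : ZMod 9))
    = 5 * k.val + i.val := by decide +kernel

theorem F2' : ∀ x y : ZMod 9, T x y = 80 ∨
    (T x y < 80 ∧ x = (mx (Fin.ofNat 16 (T x y / 5)) : ZMod 9) + (ox (Fin.ofNat 16 (T x y / 5)) (Fin.ofNat 5 (T x y % 5)) : ZMod 9)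
    ∧ y = (my (Fin.ofNat 16 (T x y / 5)) : ZMod 9) + (oy (Fin.ofNat 16 (T x y / 5)) (Fin.ofNat 5 (T x y % 5)) : ZMod 9)) := by
  decide +kernel

theorem F2 (x y : ZMod 9) (h : T x y ≠ 80) : ∃ k i, x = (mx k : ZMod 9) + (ox k i : ZMod 9) ∧
    y = (my k : ZMod 9) + (oy k i : ZMod 9) :=
  ⟨_, _, ((F2' x y).resolve_left h).2⟩

theorem F3 : ∀ x y : ZMod 9,
    ((T x y = 80 ∨ T (x + 1) y = 80 ∨ T x y / 5 = T (x + 1) y / 5) → ok (fc (T x y)) (fc (T (x + 1) y)) = true) ∧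
    ((T x y = 80 ∨ T x (y + 1) = 80 ∨ T x y / 5 = T x (y + 1) / 5) → ok (fc (T x y)) (fc (T x (y + 1))) = true) := by
  decide +kernel

theorem F5 : ∀ k : Fin 16, ∀ i : Fin 4,
    (ox k i.castSucc = ox k i.succ ∧ (oy k i.succ = oy k i.castSucc + 1 ∨ oy k i.succ = oy k i.castSucc - 1)) ∨
    (oy k i.castSucc = oy k i.succ ∧ (ox k i.succ = ox k i.castSucc + 1 ∨ ox k i.succ = ox k i.castSucc - 1)) := by
  decide +kernel

theorem F6 : ∀ a b : Fin 6, ok a b = true → ∀ c, ok b c = true → (a = c → a = 5) →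
    ∀ d, ok c d = true → (b = d → b = 5) → ∀ e, ok d e = true → (c = e → c = 5) →
    (a = 0 ∧ b = 1 ∧ c = 2 ∧ d = 3 ∧ e = 4) ∨ (a = 4 ∧ b = 3 ∧ c = 2 ∧ d = 1 ∧ e = 0) := by
  decide +kernel

theorem fc_of (k : Fin 16) (i : Fin 5) : fc (5 * k.val + i.val) = i.castSucc := by
  revert k i; decide +kernel

variable {n : ℕ}

/-- reduction mod 9 -/
def pr (n : ℕ) : ZMod (9 * n) →+* ZMod 9 := ZMod.castHom (dvd_mul_right 9 n) (ZMod 9)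

def vt (u v : ZMod (9 * n)) (k : Fin 16) (i : Fin 5) : Fin 2 → ZMod (9 * n) :=
  ![u + (ox k i : ZMod (9 * n)), v + (oy k i : ZMod (9 * n))]

theorem off_inj (k : Fin 16) (i j : Fin 5) (h1 : (ox k i : ZMod 9) = ox k j)
    (h2 : (oy k i : ZMod 9) = oy k j) : i = j := by
  have a := F1 k i
  have b := F1 k j
  rw [h1, h2, b] at a
  ext; omega

theorem vt_inj (u v : ZMod (9 * n)) (k : Fin 16) : Function.Injective (vt u v k) := by
  intro i j h
  have h0 := congrArg (pr n) (add_left_cancel (congrFun h 0))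
  have h1 := congrArg (pr n) (add_left_cancel (congrFun h 1))
  simp only [map_intCast] at h0 h1
  exact off_inj k i j h0 h1

def pth (u v : ZMod (9 * n)) (k : Fin 16) : SAPath (9 * n) 2 5 where
  toFun := vt u v k
  inj := vt_inj u v k
  adj := by
    intro i h
    have h5 := F5 k ⟨i, by omega⟩
    simp only [Fin.castSucc_mk, Fin.succ_mk] at h5
    rcases h5 with ⟨e, h5⟩ | ⟨e, h5⟩
    · refine ⟨1, ?_, ?_⟩
      · intro j hj
        have : j = 0 := by omega
        subst this
        simp [vt, e]
      · rcases h5 with h5 | h5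
        · left; simp only [vt, h5]; simp; ring
        · right; simp only [vt, h5]; simp; ring
    · refine ⟨0, ?_, ?_⟩
      · intro j hj
        have : j = 1 := by omega
        subst this
        simp [vt, e]
      · rcases h5 with h5 | h5
        · left; simp only [vt, h5]; simp; ring
        · right; simp only [vt, h5]; simp; ring

def pol (u v : ZMod (9 * n)) (k : Fin 16) : Polymer (9 * n) 2 5 := Quotient.mk _ (pth u v k)

theorem mem_pol (u v : ZMod (9 * n)) (k : Fin 16) (q) :
    q ∈ (pol u v k).support ↔ ∃ i, vt u v k i = q := Iff.rfl

def bs (m : ℕ) (x : Fin n) : ZMod (9 * n) := ((9 * x.val + m : ℕ) : ZMod (9 * n))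

theorem pr_bs (m : ℕ) (x : Fin n) : pr n (bs m x) = m := by
  have : (9 : ZMod 9) = 0 := rfl
  rw [bs, map_natCast]
  push_cast
  rw [this]
  ring

theorem mx_lt : ∀ k, mx k < 9 := by decide
theorem my_lt : ∀ k, my k < 9 := by decide

theorem bs_inj (m : ℕ) (hm : m < 9) (x y : Fin n) (h : bs m x = bs m y) : x = y := by
  unfold bs at h
  rw [ZMod.natCast_eq_natCast_iff'] at h
  have hx := x.2
  have hy := y.2
  rw [Nat.mod_eq_of_lt (by omega), Nat.mod_eq_of_lt (by omega)] at h
  ext; omega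

theorem bs_surj (hn : 1 ≤ n) (m : ℕ) (hm : m < 9) (u : ZMod (9 * n)) (h : pr n u = m) :
    ∃ x : Fin n, bs m x = u := by
  have : NeZero (9 * n) := ⟨by omega⟩
  have hu := ZMod.val_lt u
  have e : ((u.val : ℕ) : ZMod 9) = (m : ZMod 9) := by
    rw [← h]
    conv_rhs => rw [← ZMod.natCast_zmod_val u]
    rw [map_natCast]
  rw [ZMod.natCast_eq_natCast_iff'] at e
  refine ⟨⟨u.val / 9, by omega⟩, ?_⟩
  unfold bs
  conv_rhs => rw [← ZMod.natCast_zmod_val u]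
  congr 1
  simp only
  omega

def TT (q : Fin 2 → ZMod (9 * n)) : ℕ := T (pr n (q 0)) (pr n (q 1))

theorem TT_vt (x y : Fin n) (k : Fin 16) (i : Fin 5) :
    TT (vt (bs (mx k) x) (bs (my k) y) k i) = 5 * k.val + i.val := by
  simp only [TT, vt, Matrix.cons_val_zero, Matrix.cons_val_one, map_add, pr_bs, map_intCast]
  exact F1 k i

theorem key (x y x' y' : Fin n) (k k' : Fin 16) (i i' : Fin 5) (s : ZMod (9 * n))
    (h : vt (bs (mx k) x + s) (bs (my k) y) k i = vt (bs (mx k') x' + s) (bs (my k') y') k' i') :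
    x = x' ∧ y = y' ∧ k = k' ∧ i = i' := by
  have h' : vt (bs (mx k) x) (bs (my k) y) k i = vt (bs (mx k') x') (bs (my k') y') k' i' := by
    have h0 := congrFun h 0
    have h1 := congrFun h 1
    simp only [vt, Matrix.cons_val_zero, Matrix.cons_val_one] at h0 h1
    simp only [vt]
    rw [h1]
    congr 1
    linear_combination h0
  have e := congrArg TT h'
  rw [TT_vt, TT_vt] at e
  have ek : k = k' := by ext; omega
  have ei : i = i' := by ext; omega
  subst ek ei
  have h0 := add_right_cancel (congrFun h' 0)
  have h1 := add_right_cancel (congrFun h' 1)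
  exact ⟨bs_inj _ (mx_lt k) _ _ h0, bs_inj _ (my_lt k) _ _ h1, rfl, rfl⟩

def g (s : ZMod (9 * n)) (t : Fin n × Fin n × Fin 16) : Polymer (9 * n) 2 5 :=
  pol (bs (mx t.2.2) t.1 + s) (bs (my t.2.2) t.2.1) t.2.2

theorem g_meet (s : ZMod (9 * n)) (t t' : Fin n × Fin n × Fin 16) (q)
    (h : q ∈ (g s t).support) (h' : q ∈ (g s t').support) : t = t' := by
  obtain ⟨i, h⟩ := (mem_pol _ _ _ _).1 h
  obtain ⟨i', h'⟩ := (mem_pol _ _ _ _).1 h'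
  obtain ⟨a, b, c, -⟩ := key _ _ _ _ _ _ _ _ s (h.trans h'.symm)
  exact Prod.ext a (Prod.ext b c)

theorem g_inj (s : ZMod (9 * n)) : Function.Injective (g s) := by
  intro t t' h
  refine g_meet s t t' _ ((mem_pol _ _ _ _).2 ⟨0, rfl⟩) ?_
  rw [← h]
  exact (mem_pol _ _ _ _).2 ⟨0, rfl⟩

noncomputable def cfg (n : ℕ) (s : ZMod (9 * n)) : Config (9 * n) 2 5 (16 * n ^ 2) where
  polymers := Finset.univ.image (g s)
  card_eq := by
    rw [Finset.card_image_of_injective _ (g_inj s)]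
    simp
    ring
  disj := by
    intro P hP Q hQ hne
    obtain ⟨t, -, rfl⟩ := Finset.mem_image.1 hP
    obtain ⟨t', -, rfl⟩ := Finset.mem_image.1 hQ
    rw [Set.disjoint_left]
    intro q h h'
    exact hne (congrArg _ (g_meet s t t' q h h'))

theorem mem_cfg (s : ZMod (9 * n)) (P) : P ∈ (cfg n s).polymers ↔ ∃ t, g s t = P := by
  simp [cfg]

/-- every non-hole vertex is covered -/
theorem cover (hn : 1 ≤ n) (q : Fin 2 → ZMod (9 * n)) (h : TT q ≠ 80) :
    ∃ x y k i, vt (bs (mx k) x) (bs (my k) y) k i = q := by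
  obtain ⟨k, i, h0, h1⟩ := F2 _ _ h
  obtain ⟨x, hx⟩ := bs_surj hn (mx k) (mx_lt k) (q 0 - (ox k i : ZMod (9 * n))) (by simp [h0])
  obtain ⟨y, hy⟩ := bs_surj hn (my k) (my_lt k) (q 1 - (oy k i : ZMod (9 * n))) (by simp [h1])
  refine ⟨x, y, k, i, ?_⟩
  funext j
  fin_cases j <;> simp [vt, hx, hy]

theorem cfg_ne (hn : 1 ≤ n) : cfg n 0 ≠ cfg n 1 := by
  intro h
  obtain ⟨x, y, k, i, hq⟩ := cover hn ![-1, 0] (by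
    simp only [TT, Matrix.cons_val_zero, Matrix.cons_val_one, map_neg, map_one, map_zero]
    decide +kernel)
  have m1 : g 1 (x, y, k) ∈ (cfg n 1).polymers := (mem_cfg _ _).2 ⟨_, rfl⟩
  rw [← h] at m1
  obtain ⟨⟨x', y', k'⟩, ht⟩ := (mem_cfg _ _).1 m1
  have z : ![0, 0] ∈ (g 1 (x, y, k)).support := by
    refine (mem_pol _ _ _ _).2 ⟨i, ?_⟩
    have h0 := congrFun hq 0
    have h1 := congrFun hq 1
    simp only [vt, Matrix.cons_val_zero, Matrix.cons_val_one] at h0 h1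
    simp only [vt]
    rw [h1]
    congr 1
    linear_combination h0
  rw [← ht] at z
  obtain ⟨i', hi⟩ := (mem_pol _ _ _ _).1 z
  simp only [add_zero] at hi
  have e := congrArg TT hi
  rw [TT_vt] at e
  have : TT (n := n) ![0, 0] = 80 := by
    simp only [TT, Matrix.cons_val_zero, Matrix.cons_val_one, map_zero]
    decide +kernel
  rw [this] at e
  omega

theorem adj_ok (p q : Fin 2 → ZMod (9 * n)) (h : torusAdj (9 * n) 2 p q)
    (hk : TT p = 80 ∨ TT q = 80 ∨ TT p / 5 = TT q / 5) : ok (fc (TT p)) (fc (TT q)) = true := by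
  obtain ⟨i, hj, hi⟩ := h
  unfold TT at *
  fin_cases i
  · have e := hj 1 (by decide)
    rcases hi with hi | hi
    · simp only [Fin.zero_eta] at hi
      rw [← e, hi, map_add, map_one] at hk ⊢
      exact (F3 _ _).1 hk
    · simp only [Fin.zero_eta] at hi
      have hi' : p 0 = q 0 + 1 := by rw [hi]; ring
      rw [e, hi', map_add, map_one] at hk ⊢
      apply ok_symm
      apply (F3 _ _).1
      tauto
  · have e := hj 0 (by decide)
    rcases hi with hi | hi
    · simp only [Fin.mk_one] at hi
      rw [← e, hi, map_add, map_one] at hk ⊢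
      exact (F3 _ _).2 hk
    · simp only [Fin.mk_one] at hi
      have hi' : p 1 = q 1 + 1 := by rw [hi]; ring
      rw [e, hi', map_add, map_one] at hk ⊢
      apply ok_symm
      apply (F3 _ _).2
      tauto

/-- a path contained in one polymer plus holes is that polymer -/
theorem rigid (u v : ZMod (9 * n)) (k : Fin 16) (hT : ∀ i, TT (vt u v k i) = 5 * k.val + i.val)
    (p : SAPath (9 * n) 2 5)
    (h : ∀ j, TT (p.toFun j) = 80 ∨ ∃ i, vt u v k i = p.toFun j) :
    (Quotient.mk _ p : Polymer (9 * n) 2 5) = pol u v k := by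
  have A : ∀ j (hj : j + 1 < 5), ok (fc (TT (p.toFun ⟨j, Nat.lt_of_succ_lt hj⟩)))
      (fc (TT (p.toFun ⟨j + 1, hj⟩))) = true := by
    intro j hj
    apply adj_ok _ _ (p.adj j hj)
    rcases h ⟨j, Nat.lt_of_succ_lt hj⟩ with a | ⟨i, a⟩
    · exact Or.inl a
    rcases h ⟨j + 1, hj⟩ with b | ⟨i', b⟩
    · exact Or.inr (Or.inl b)
    right; right
    rw [← a, ← b, hT, hT]
    omega
  have V : ∀ j (i : Fin 5), fc (TT (p.toFun j)) = i.castSucc → p.toFun j = vt u v k i := by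
    intro j i e
    rcases h j with a | ⟨i', a⟩
    · rw [a] at e
      exfalso
      revert e; revert i; decide
    · rw [← a, hT, fc_of] at e
      rw [← a, Fin.castSucc_injective _ e]
  have B : ∀ j j', j ≠ j' → fc (TT (p.toFun j)) = fc (TT (p.toFun j')) → fc (TT (p.toFun j)) = 5 := by
    intro j j' hne e
    by_contra hc
    have : ∃ i : Fin 5, fc (TT (p.toFun j)) = i.castSucc := by
      revert hc; generalize fc (TT (p.toFun j)) = z; revert z; decide
    obtain ⟨i, hi⟩ := this
    exact hne (p.inj ((V j i hi).trans (V j' i (e ▸ hi)).symm))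
  have := F6 _ _ (A 0 (by omega)) _ (A 1 (by omega)) (B _ _ (by decide)) _ (A 2 (by omega))
    (B _ _ (by decide)) _ (A 3 (by omega)) (B _ _ (by decide))
  apply Quotient.sound
  rcases this with ⟨a, b, c, d, e⟩ | ⟨a, b, c, d, e⟩
  · left
    have a := V _ 0 a
    have b := V _ 1 b
    have c := V _ 2 c
    have d := V _ 3 d
    have e := V _ 4 e
    funext j
    fin_cases j
    exacts [a.symm, b.symm, c.symm, d.symm, e.symm]
  · right
    have a := V _ 4 a
    have b := V _ 3 b
    have c := V _ 2 c
    have d := V _ 1 d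
    have e := V _ 0 e
    funext j
    fin_cases j
    exacts [e.symm, d.symm, c.symm, b.symm, a.symm]

theorem isolated (hn : 1 ≤ n) (S : Config (9 * n) 2 5 (16 * n ^ 2)) :
    ¬ (configGraph (9 * n) 2 5 (16 * n ^ 2)).Adj (cfg n 0) S := by
  rintro ⟨-, hc⟩
  have hN : 1 ≤ 16 * n ^ 2 := by nlinarith
  have c1 := Finset.card_sdiff_add_card_inter (cfg n 0).polymers S.polymers
  have c2 := Finset.card_sdiff_add_card_inter S.polymers (cfg n 0).polymers
  rw [Finset.inter_comm] at c2
  rw [hc, Config.card_eq] at c1 c2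
  obtain ⟨P, hP⟩ := Finset.card_eq_one.1 (show ((cfg n 0).polymers \ S.polymers).card = 1 by omega)
  obtain ⟨Q, hQ⟩ := Finset.card_eq_one.1 (show (S.polymers \ (cfg n 0).polymers).card = 1 by omega)
  have hP0 : P ∈ (cfg n 0).polymers := (Finset.mem_sdiff.1 (hP ▸ Finset.mem_singleton_self P)).1
  obtain ⟨hQS, hQ0⟩ := Finset.mem_sdiff.1 (hQ ▸ Finset.mem_singleton_self Q)
  have hd : ∀ R ∈ (cfg n 0).polymers, R ≠ P → Disjoint R.support Q.support := by
    intro R hR hRP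
    have hRS : R ∈ S.polymers := by
      by_contra hc
      have : R ∈ (cfg n 0).polymers \ S.polymers := Finset.mem_sdiff.2 ⟨hR, hc⟩
      rw [hP] at this
      exact hRP (Finset.mem_singleton.1 this)
    exact S.disj R hRS Q hQS (fun e => hQ0 (e ▸ hR))
  obtain ⟨⟨x, y, k⟩, rfl⟩ := (mem_cfg _ _).1 hP0
  obtain ⟨q, rfl⟩ := Quotient.exists_rep Q
  apply hQ0
  refine (mem_cfg _ _).2 ⟨(x, y, k), ?_⟩
  symm
  apply rigid
  · intro i
    simp only [add_zero]
    exact TT_vt x y k i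
  · intro j
    by_cases h80 : TT (q.toFun j) = 80
    · exact Or.inl h80
    right
    obtain ⟨x', y', k', i, hv⟩ := cover hn _ h80
    have m : q.toFun j ∈ (g 0 (x', y', k')).support := by
      refine (mem_pol _ _ _ _).2 ⟨i, ?_⟩
      simp only [add_zero]
      exact hv
    have e : g 0 (x', y', k') = g 0 (x, y, k) := by
      by_contra hne
      exact Set.disjoint_left.1 (hd _ ((mem_cfg _ _).2 ⟨_, rfl⟩) hne) m ⟨j, rfl⟩
    rw [e] at m
    exact (mem_pol _ _ _ _).1 m

end Pol

/-- for `a = 9n`, `L = 5`, `N = 16n²` (density `80/81`), the configuration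
graph on the two-dimensional torus of side `a` is not connected. -/
theorem configGraph_not_preconnected_80_81
    (n : ℕ) (hn : 1 ≤ n) :
    ¬ (configGraph (9 * n) 2 5 (16 * n ^ 2)).Preconnected := by
  intro h
  obtain ⟨w⟩ := h (Pol.cfg n 0) (Pol.cfg n 1)
  have hne := Pol.cfg_ne hn
  generalize Pol.cfg n 1 = S at w hne
  cases w with
  | nil => exact hne rfl
  | cons h _ => exact Pol.isolated hn _ h
end

section
/- Let q_o, q_n, η be positive real numbers, let A and B be finite types, and let u_A : A → ℝ, u_B : B → ℝ be nonnegative functions and W_A : A → ℝ, W_B : B → ℝ be positive functions. Define P_f = Σ_{g ∈ A} Σ_{g' ∈ B} u_A(g) · (W_A(g))⁻¹ · η · u_B(g') · min(1, (q_n · W_A(g)) / (q_o · W_B(g'))) and P_b = Σ_{g' ∈ B} Σ_{g ∈ A} u_B(g') · (W_B(g'))⁻¹ · η · u_A(g) · min(1, (q_o · W_B(g')) / (q_n · W_A(g))). Then q_o · P_f = q_n · P_b. -/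
open Finset in
/-- the detailed-balance identity for the Recoil Growth algorithm. -/
theorem recoil_growth_detailed_balance
    (qo qn η : ℝ) (hqo : 0 < qo) (hqn : 0 < qn) (hη : 0 < η)
    (A B : Type) [Fintype A] [Fintype B]
    (uA : A → ℝ) (uB : B → ℝ) (huA : ∀ g, 0 ≤ uA g) (huB : ∀ g', 0 ≤ uB g')
    (WA : A → ℝ) (WB : B → ℝ) (hWA : ∀ g, 0 < WA g) (hWB : ∀ g', 0 < WB g') :
    qo * (∑ g : A, ∑ g' : B,
        uA g * (WA g)⁻¹ * η * uB g' * min 1 ((qn * WA g) / (qo * WB g'))) =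
      qn * (∑ g' : B, ∑ g : A,
        uB g' * (WB g')⁻¹ * η * uA g * min 1 ((qo * WB g') / (qn * WA g))) := by
  rw [Finset.sum_comm, Finset.mul_sum, Finset.mul_sum]
  refine Finset.sum_congr rfl fun g' _ => ?_
  rw [Finset.mul_sum, Finset.mul_sum]
  refine Finset.sum_congr rfl fun g _ => ?_
  have ha := hWA g
  have hb := hWB g'
  have h1 : 0 < qn * WA g := mul_pos hqn ha
  have h2 : 0 < qo * WB g' := mul_pos hqo hb
  rcases le_total (qn * WA g) (qo * WB g') with h | h
  · rw [min_eq_right ((div_le_one h2).2 h), min_eq_left ((one_le_div h1).2 h)]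
    field_simp
  · rw [min_eq_left ((one_le_div h2).2 h), min_eq_right ((div_le_one h1).2 h)]
    field_simp
end

section
/- Let q_o, q_n, η be positive real numbers, let A and B be finite types, let u_A : A → ℝ, u_B : B → ℝ be nonnegative functions, and let W_A, W⁰_A : A → ℝ and W_B, W⁰_B : B → ℝ be positive functions. Define P_f = Σ_{g ∈ A} Σ_{g' ∈ B} u_A(g) · (W_A(g))⁻¹ · η · u_B(g') · (W⁰_B(g'))⁻¹ · min(1, (q_n · W_A(g) · (W⁰_A(g))⁻¹) / (q_o · W_B(g') · (W⁰_B(g'))⁻¹)) and P_b = Σ_{g' ∈ B} Σ_{g ∈ A} u_B(g') · (W_B(g'))⁻¹ · η · u_A(g) · (W⁰_A(g))⁻¹ · min(1, (q_o · W_B(g') · (W⁰_B(g'))⁻¹) / (q_n · W_A(g) · (W⁰_A(g))⁻¹)). Then q_o · P_f = q_n · P_b. -/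
open Finset in
/-- the detailed-balance identity for the extended Recoil Growth algorithm
(underlying graphs with random out-degrees). -/
theorem extended_recoil_growth_detailed_balance
    (qo qn η : ℝ) (hqo : 0 < qo) (hqn : 0 < qn) (hη : 0 < η)
    (A B : Type) [Fintype A] [Fintype B]
    (uA : A → ℝ) (uB : B → ℝ) (huA : ∀ g, 0 ≤ uA g) (huB : ∀ g', 0 ≤ uB g')
    (WA W0A : A → ℝ) (WB W0B : B → ℝ)
    (hWA : ∀ g, 0 < WA g) (hW0A : ∀ g, 0 < W0A g)
    (hWB : ∀ g', 0 < WB g') (hW0B : ∀ g', 0 < W0B g') :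
    qo * (∑ g : A, ∑ g' : B,
        uA g * (WA g)⁻¹ * η * uB g' * (W0B g')⁻¹ *
          min 1 ((qn * WA g * (W0A g)⁻¹) / (qo * WB g' * (W0B g')⁻¹))) =
      qn * (∑ g' : B, ∑ g : A,
        uB g' * (WB g')⁻¹ * η * uA g * (W0A g)⁻¹ *
          min 1 ((qo * WB g' * (W0B g')⁻¹) / (qn * WA g * (W0A g)⁻¹))) := by
  rw [Finset.sum_comm, Finset.mul_sum, Finset.mul_sum]
  refine Finset.sum_congr rfl fun g' _ => ?_
  rw [Finset.mul_sum, Finset.mul_sum]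
  refine Finset.sum_congr rfl fun g _ => ?_
  have h1 := hWA g
  have h2 := hW0A g
  have h3 := hWB g'
  have h4 := hW0B g'
  have key : ∀ x y : ℝ, 0 < x → 0 < y → y * min 1 (x / y) = x * min 1 (y / x) := by
    intro x y hx hy
    rw [mul_min_of_nonneg _ _ hy.le, mul_min_of_nonneg _ _ hx.le, mul_div_cancel₀ _ hy.ne',
      mul_div_cancel₀ _ hx.ne', mul_one, mul_one, min_comm]
  have k := key (qn * WA g * (W0A g)⁻¹) (qo * WB g' * (W0B g')⁻¹) (by positivity) (by positivity)
  generalize min 1 ((qn * WA g * (W0A g)⁻¹) / (qo * WB g' * (W0B g')⁻¹)) = m at k ⊢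
  generalize min 1 ((qo * WB g' * (W0B g')⁻¹) / (qn * WA g * (W0A g)⁻¹)) = n at k ⊢
  have e1 : (WA g)⁻¹ * WA g = 1 := inv_mul_cancel₀ h1.ne'
  have e3 : (WB g')⁻¹ * WB g' = 1 := inv_mul_cancel₀ h3.ne'
  linear_combination (uA g * uB g' * η * (WA g)⁻¹ * (WB g')⁻¹) * k
    - (qo * uA g * (WA g)⁻¹ * η * uB g' * (W0B g')⁻¹ * m) * e3
    + (qn * uB g' * (WB g')⁻¹ * η * uA g * (W0A g)⁻¹ * n) * e1
end
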